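/- Let (X,d) be a metric space, f : X → X a continuous map, K ⊆ X a compact set and α ≥ 0. Then h_est,cov(α,K) = h_est(α,K), i.e., the supremum of h(f;𝒰_∞) over all (α,K)-admissible sequences of open covers 𝒰_∞ equals the estimation entropy defined via spanning sets. -/

import Mathlib

open Filter Metric Set

/-- Minimal cardinality of an `(n,ε,α,K)`-spanning set for `f`. -/
noncomputable def spanNum {X : Type*} [MetricSpace X] (f : X → X) (K : Set X)
    (α : ℝ) (n : ℕ) (ε : ℝ) : ℕ :=
  sInf {m : ℕ | ∃ S : Finset X, ↑S ⊆ K ∧ S.card = m ∧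
    ∀ x ∈ K, ∃ y ∈ S, ∀ t : ℕ, t ≤ n →
      dist (f^[t] x) (f^[t] y) < ε * Real.exp (-α * t)}

/-- Estimation entropy via spanning sets (base-2 logarithm); the limit as `ε ↓ 0`
is realized as the supremum over `ε > 0`, by monotonicity. -/
noncomputable def estEntropySpan {X : Type*} [MetricSpace X] (f : X → X) (K : Set X)
    (α : ℝ) : EReal :=
  ⨆ ε ∈ Set.Ioi (0 : ℝ),
    atTop.limsup fun n : ℕ => ((Real.logb 2 (spanNum f K α n ε) / n : ℝ) : EReal)

/-- A sequence `𝒰 k` of covers of `K_k := f^k(K)` is `(α,K)`-admissible if each `𝒰 k`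
is a cover of `K_k` by relatively open subsets of `K_k` and there is `ε > 0` such that
the Lebesgue number of `𝒰 k` is at least `ε·e^{-αk}`, i.e. every ball of radius
`ε·e^{-αk}` in `K_k` is contained in a member of `𝒰 k`. -/
def IsAdmissibleCoverSeq {X : Type*} [MetricSpace X] (f : X → X) (K : Set X)
    (α : ℝ) (𝒰 : ℕ → Set (Set X)) : Prop :=
  (∀ k, ∀ U ∈ 𝒰 k, ∃ V : Set X, IsOpen V ∧ U = V ∩ f^[k] '' K) ∧
  (∀ k, f^[k] '' K ⊆ ⋃₀ 𝒰 k) ∧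
  (∃ ε > (0 : ℝ), ∀ k, ∀ x ∈ f^[k] '' K, ∃ U ∈ 𝒰 k,
    ∀ y ∈ f^[k] '' K, dist y x < ε * Real.exp (-α * k) → y ∈ U)

/-- Minimal cardinality of a subcover of `K` from the join `⋁_{i=0}^n f^{-i} 𝒰 i`,
where members of the join are encoded by the choice functions `g` selecting
`g i ∈ 𝒰 i` for `0 ≤ i ≤ n`. -/
noncomputable def joinCoverNum {X : Type*} (f : X → X) (K : Set X)
    (𝒰 : ℕ → Set (Set X)) (n : ℕ) : ℕ :=
  sInf {m : ℕ | ∃ F : Finset (ℕ → Set X), F.card = m ∧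
    (∀ g ∈ F, ∀ i : ℕ, i ≤ n → g i ∈ 𝒰 i) ∧
    ∀ x ∈ K, ∃ g ∈ F, ∀ i : ℕ, i ≤ n → f^[i] x ∈ g i}

/-- The entropy of `f` with respect to the sequence of covers `𝒰` (base-2 logarithm). -/
noncomputable def coverSeqEntropy {X : Type*} (f : X → X) (K : Set X)
    (𝒰 : ℕ → Set (Set X)) : EReal :=
  atTop.limsup fun n : ℕ => ((Real.logb 2 (joinCoverNum f K 𝒰 n) / n : ℝ) : EReal)

/-- Estimation entropy via open covers: the supremum of the cover entropies over all
`(α,K)`-admissible sequences of covers. -/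
noncomputable def estEntropyCov {X : Type*} [MetricSpace X] (f : X → X) (K : Set X)
    (α : ℝ) : EReal :=
  ⨆ 𝒰 : ℕ → Set (Set X), ⨆ _ : IsAdmissibleCoverSeq f K α 𝒰, coverSeqEntropy f K 𝒰

theorem exists_finset_spanning {X : Type*} [MetricSpace X] {f : X → X} (hf : Continuous f)
    {K : Set X} (hK : IsCompact K) (α : ℝ) (n : ℕ) {ε : ℝ} (hε : 0 < ε) :
    ∃ S : Finset X, ↑S ⊆ K ∧ ∀ x ∈ K, ∃ y ∈ S, ∀ t : ℕ, t ≤ n →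
      dist (f^[t] x) (f^[t] y) < ε * Real.exp (-α * t) := by
  have hU : ∀ y ∈ K, {x | ∀ t ∈ Set.Iic n,
      dist (f^[t] x) (f^[t] y) < ε * Real.exp (-α * t)} ∈ nhds y := by
    intro y _
    refine IsOpen.mem_nhds ?_ ?_
    · have : {x | ∀ t ∈ Set.Iic n, dist (f^[t] x) (f^[t] y) < ε * Real.exp (-α * t)} =
          ⋂ t ∈ Set.Iic n, {x | dist (f^[t] x) (f^[t] y) < ε * Real.exp (-α * t)} := by
        ext; simp
      rw [this]
      exact (Set.finite_Iic n).isOpen_biInter fun t _ =>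
        isOpen_lt ((hf.iterate t).dist continuous_const) continuous_const
    · intro t _
      rw [dist_self]
      positivity
  obtain ⟨S, hSK, hS⟩ := hK.elim_nhds_subcover _ hU
  refine ⟨S, hSK, fun x hx => ?_⟩
  obtain ⟨y, hy, hxy⟩ := Set.mem_iUnion₂.1 (hS hx)
  exact ⟨y, hy, hxy⟩

theorem exists_finset_card_eq_spanNum {X : Type*} [MetricSpace X] {f : X → X}
    (hf : Continuous f) {K : Set X} (hK : IsCompact K) (α : ℝ) (n : ℕ) {ε : ℝ} (hε : 0 < ε) :
    ∃ S : Finset X, ↑S ⊆ K ∧ S.card = spanNum f K α n ε ∧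
      ∀ x ∈ K, ∃ y ∈ S, ∀ t : ℕ, t ≤ n →
        dist (f^[t] x) (f^[t] y) < ε * Real.exp (-α * t) := by
  obtain ⟨S, hSK, hS⟩ := exists_finset_spanning hf hK α n hε
  exact Nat.sInf_mem (s := {m : ℕ | ∃ S : Finset X, ↑S ⊆ K ∧ S.card = m ∧
    ∀ x ∈ K, ∃ y ∈ S, ∀ t : ℕ, t ≤ n →
      dist (f^[t] x) (f^[t] y) < ε * Real.exp (-α * t)}) ⟨_, S, hSK, rfl, hS⟩

/-- If balls of radius `ε * exp (-α * k)` in `f^[k] '' K` are subordinate to `𝒰 k`, then the join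
has a subcover with at most `spanNum f K α n ε` members. -/
theorem exists_finset_join_cover {X : Type*} [MetricSpace X] {f : X → X}
    (hf : Continuous f) {K : Set X} (hK : IsCompact K) {α ε : ℝ} (hε : 0 < ε)
    {𝒰 : ℕ → Set (Set X)}
    (h𝒰 : ∀ k : ℕ, ∀ x ∈ f^[k] '' K, ∃ U ∈ 𝒰 k,
      ∀ y ∈ f^[k] '' K, dist y x < ε * Real.exp (-α * k) → y ∈ U) (n : ℕ) :
    ∃ F : Finset (ℕ → Set X), F.card ≤ spanNum f K α n ε ∧
      (∀ g ∈ F, ∀ i : ℕ, i ≤ n → g i ∈ 𝒰 i) ∧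
      ∀ x ∈ K, ∃ g ∈ F, ∀ i : ℕ, i ≤ n → f^[i] x ∈ g i := by
  classical
  obtain ⟨S, hSK, hcard, hS⟩ := exists_finset_card_eq_spanNum hf hK α n hε
  have h : ∀ y : X, ∃ g : ℕ → Set X, y ∈ K → ∀ i, g i ∈ 𝒰 i ∧
      ∀ z ∈ f^[i] '' K, dist z (f^[i] y) < ε * Real.exp (-α * i) → z ∈ g i := by
    intro y
    by_cases hy : y ∈ K
    · choose g hg using fun i => h𝒰 i (f^[i] y) (Set.mem_image_of_mem _ hy)
      exact ⟨g, fun _ => hg⟩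
    · exact ⟨fun _ => ∅, fun h => absurd h hy⟩
  choose G hG using h
  refine ⟨S.image G, hcard ▸ Finset.card_image_le, ?_, ?_⟩
  · intro g hg i _
    obtain ⟨y, hy, rfl⟩ := Finset.mem_image.1 hg
    exact (hG y (hSK hy) i).1
  · intro x hx
    obtain ⟨y, hy, hxy⟩ := hS x hx
    exact ⟨G y, Finset.mem_image_of_mem _ hy, fun i hi =>
      (hG y (hSK hy) i).2 _ (Set.mem_image_of_mem _ hx) (hxy i hi)⟩

theorem joinCoverNum_le_spanNum {X : Type*} [MetricSpace X] {f : X → X}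
    (hf : Continuous f) {K : Set X} (hK : IsCompact K) {α ε : ℝ} (hε : 0 < ε)
    {𝒰 : ℕ → Set (Set X)}
    (h𝒰 : ∀ k : ℕ, ∀ x ∈ f^[k] '' K, ∃ U ∈ 𝒰 k,
      ∀ y ∈ f^[k] '' K, dist y x < ε * Real.exp (-α * k) → y ∈ U) (n : ℕ) :
    joinCoverNum f K 𝒰 n ≤ spanNum f K α n ε := by
  obtain ⟨F, hcard, hF⟩ := exists_finset_join_cover hf hK hε h𝒰 n
  exact le_trans (Nat.sInf_le ⟨F, rfl, hF⟩) hcard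

theorem spanNum_le_card {X : Type*} [MetricSpace X] {f : X → X} {K : Set X} {α ε : ℝ} {n : ℕ}
    {F : Finset (ℕ → Set X)}
    (hdist : ∀ g ∈ F, ∀ i : ℕ, i ≤ n → ∀ y ∈ g i, ∀ z ∈ g i,
      dist y z < ε * Real.exp (-α * i))
    (hF : ∀ x ∈ K, ∃ g ∈ F, ∀ i : ℕ, i ≤ n → f^[i] x ∈ g i) :
    spanNum f K α n ε ≤ F.card := by
  classical
  let P : (ℕ → Set X) → X → Prop := fun g x => x ∈ K ∧ ∀ i : ℕ, i ≤ n → f^[i] x ∈ g i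
  let F' := F.filter fun g => ∃ x, P g x
  have h : ∀ g : F', ∃ x, P g x := fun g => (Finset.mem_filter.1 g.2).2
  choose c hc using h
  have hcard : (F'.attach.image c).card ≤ F.card :=
    Finset.card_image_le.trans (Finset.card_attach.le.trans (Finset.card_filter_le _ _))
  refine le_trans (Nat.sInf_le ⟨F'.attach.image c, ?_, rfl, ?_⟩) hcard
  · intro y hy
    obtain ⟨g, _, rfl⟩ := Finset.mem_image.1 (Finset.mem_coe.1 hy)
    exact (hc g).1
  · intro x hx
    obtain ⟨g, hg, hxg⟩ := hF x hx
    have hg' : g ∈ F' := Finset.mem_filter.2 ⟨hg, x, hx, hxg⟩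
    exact ⟨c ⟨g, hg'⟩, Finset.mem_image_of_mem _ (Finset.mem_attach _ _), fun t ht =>
      hdist g hg t ht _ (hxg t ht) _ ((hc ⟨g, hg'⟩).2 t ht)⟩

theorem spanNum_le_joinCoverNum {X : Type*} [MetricSpace X] {f : X → X}
    (hf : Continuous f) {K : Set X} (hK : IsCompact K) {α ε : ℝ} {𝒰 : ℕ → Set (Set X)}
    (h𝒰 : IsAdmissibleCoverSeq f K α 𝒰)
    (hdist : ∀ i : ℕ, ∀ U ∈ 𝒰 i, ∀ y ∈ U, ∀ z ∈ U, dist y z < ε * Real.exp (-α * i)) (n : ℕ) :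
    spanNum f K α n ε ≤ joinCoverNum f K 𝒰 n := by
  obtain ⟨-, -, δ, hδ, hL⟩ := h𝒰
  obtain ⟨F₀, -, hF₀⟩ := exists_finset_join_cover hf hK hδ hL n
  obtain ⟨F, hcard, hF𝒰, hF⟩ := Nat.sInf_mem (s := {m : ℕ | ∃ F : Finset (ℕ → Set X),
    F.card = m ∧ (∀ g ∈ F, ∀ i : ℕ, i ≤ n → g i ∈ 𝒰 i) ∧
    ∀ x ∈ K, ∃ g ∈ F, ∀ i : ℕ, i ≤ n → f^[i] x ∈ g i}) ⟨_, F₀, rfl, hF₀⟩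
  exact (spanNum_le_card (fun g hg i hi => hdist i _ (hF𝒰 g hg i hi)) hF).trans hcard.le

/-- The relative balls of radius `δ * exp (-α * k)` in `f^[k] '' K`. -/
def relBallCover {X : Type*} [MetricSpace X] (f : X → X) (K : Set X) (α δ : ℝ) (k : ℕ) :
    Set (Set X) :=
  (fun x => ball x (δ * Real.exp (-α * k)) ∩ f^[k] '' K) '' (f^[k] '' K)

theorem isAdmissibleCoverSeq_relBallCover {X : Type*} [MetricSpace X] (f : X → X) (K : Set X)
    (α : ℝ) {δ : ℝ} (hδ : 0 < δ) : IsAdmissibleCoverSeq f K α (relBallCover f K α δ) := by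
  refine ⟨?_, ?_, δ, hδ, ?_⟩
  · rintro k _ ⟨x, _, rfl⟩
    exact ⟨_, isOpen_ball, rfl⟩
  · intro k x hx
    exact ⟨_, Set.mem_image_of_mem _ hx, mem_ball_self (by positivity), hx⟩
  · intro k x hx
    exact ⟨_, Set.mem_image_of_mem _ hx, fun y hy hyx => ⟨hyx, hy⟩⟩

theorem dist_lt_of_mem_relBallCover {X : Type*} [MetricSpace X] {f : X → X} {K : Set X}
    {α ε : ℝ} {k : ℕ} {U : Set X} (hU : U ∈ relBallCover f K α (ε / 2) k) {y z : X}
    (hy : y ∈ U) (hz : z ∈ U) : dist y z < ε * Real.exp (-α * k) := by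
  obtain ⟨x, -, rfl⟩ := hU
  have h₁ := mem_ball.1 hy.1
  have h₂ := mem_ball.1 hz.1
  have h₃ := dist_triangle_right y z x
  linarith

theorem limsup_logb_div_mono {a b : ℕ → ℕ} (h : ∀ n, a n ≤ b n) :
    (atTop.limsup fun n : ℕ => ((Real.logb 2 (a n) / n : ℝ) : EReal)) ≤
      atTop.limsup fun n : ℕ => ((Real.logb 2 (b n) / n : ℝ) : EReal) := by
  refine limsup_le_limsup (Eventually.of_forall fun n => ?_)
  refine EReal.coe_le_coe_iff.2 (div_le_div_of_nonneg_right ?_ n.cast_nonneg)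
  rcases Nat.eq_zero_or_pos (a n) with h₀ | h₀
  · rw [h₀, Nat.cast_zero, Real.logb_zero]
    rcases Nat.eq_zero_or_pos (b n) with h₁ | h₁
    · simp [h₁]
    · exact Real.logb_nonneg one_lt_two (by exact_mod_cast h₁)
  · exact Real.logb_le_logb_of_le one_lt_two (by exact_mod_cast h₀) (by exact_mod_cast h n)

/-- For a continuous map `f` on a metric space, a compact set `K` and
`α ≥ 0`, the estimation entropy defined via admissible sequences of open covers
coincides with the estimation entropy defined via spanning sets. -/
theorem estimation_entropy_cov_eq_span {X : Type*} [MetricSpace X]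
    (f : X → X) (hf : Continuous f) (K : Set X) (hK : IsCompact K)
    (α : ℝ) (hα : 0 ≤ α) :
    estEntropyCov f K α = estEntropySpan f K α := by
  apply le_antisymm
  · refine iSup₂_le fun 𝒰 h𝒰 => ?_
    obtain ⟨-, -, ε, hε, hL⟩ := h𝒰
    exact (limsup_logb_div_mono (joinCoverNum_le_spanNum hf hK hε hL)).trans
      (le_iSup₂ (f := fun ε (_ : ε ∈ Set.Ioi (0 : ℝ)) =>
        atTop.limsup fun n : ℕ => ((Real.logb 2 (spanNum f K α n ε) / n : ℝ) : EReal)) ε hε)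
  · refine iSup₂_le fun ε hε => ?_
    have hadm := isAdmissibleCoverSeq_relBallCover f K α (half_pos (Set.mem_Ioi.1 hε))
    exact (limsup_logb_div_mono (spanNum_le_joinCoverNum hf hK hadm
      fun i U hU y hy z hz => dist_lt_of_mem_relBallCover hU hy hz)).trans
      (le_iSup₂ (f := fun 𝒰 (_ : IsAdmissibleCoverSeq f K α 𝒰) => coverSeqEntropy f K 𝒰) _ hadm)
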